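/- Let P: ℝ^r → ℝ be a polynomial, with degree n₁ ≥ 0 in the variable x₁, and let d ρ(x) = x₁^b⋯x_r^b ∏_j (1+x_j)^{-ν} ∏_{i<j} |x_i - x_j|^a dx on (0,∞)^r with a ≥ 0, b > -1, ν real, and p := (r-1)a + b + 2. If P ∈ L²((0,∞)^r, dρ) and P is not identically zero, then the degree of P in each variable x_j is strictly less than (ν - p + 1)/2. Conversely, every monomial x₁^{n₁}⋯x_r^{n_r} with each n_j < (ν - p + 1)/2 belongs to L²((0,∞)^r, dρ). -/

import Mathlib

open MeasureTheory

/-- The modified Selberg measure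
`dρ(x) = ∏ x_j^b ∏ (1+x_j)^{-ν} ∏_{i<j} |x_i-x_j|^a dx` on `(0,∞)^r`. -/
noncomputable def selbergMeasure (r : ℕ) (a b ν : ℝ) : Measure (Fin r → ℝ) :=
  (volume.restrict {x : Fin r → ℝ | ∀ j, 0 < x j}).withDensity fun x =>
    ENNReal.ofReal ((∏ j, x j ^ b) * (∏ j, (1 + x j) ^ (-ν)) *
      ∏ q ∈ Finset.univ.filter (fun q : Fin r × Fin r => q.1 < q.2), |x q.1 - x q.2| ^ a)

open Filter Topology Asymptotics

lemma pairs_prod (r : ℕ) (f : Fin r → ℝ) :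
    ∏ q ∈ Finset.univ.filter (fun q : Fin r × Fin r => q.1 < q.2), (f q.1 * f q.2)
      = ∏ j, f j ^ (r - 1) := by
  rw [Finset.prod_mul_distrib]
  have h2 : ∏ q ∈ Finset.univ.filter (fun q : Fin r × Fin r => q.1 < q.2), f q.2
      = ∏ q ∈ Finset.univ.filter (fun q : Fin r × Fin r => q.2 < q.1), f q.1 := by
    refine Finset.prod_bij (fun q _ => (q.2, q.1)) ?_ ?_ ?_ ?_
    · simp
    · rintro ⟨a, b⟩ _ ⟨c, d⟩ _ h
      simp at h ⊢
      tauto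
    · rintro ⟨a, b⟩ h
      exact ⟨(b, a), by simpa using h, rfl⟩
    · simp
  rw [h2, ← Finset.prod_union]
  · have : (Finset.univ.filter (fun q : Fin r × Fin r => q.1 < q.2)) ∪
        (Finset.univ.filter (fun q : Fin r × Fin r => q.2 < q.1))
        = Finset.univ.filter (fun q : Fin r × Fin r => q.2 ≠ q.1) := by
      ext q
      simp [ne_comm, lt_or_lt_iff_ne]
    rw [this, Finset.prod_filter, Fintype.prod_prod_type]
    refine Finset.prod_congr rfl fun i _ => ?_
    simp only []
    rw [← Finset.prod_filter, Finset.prod_const, Finset.filter_ne' , Finset.card_erase_of_mem (Finset.mem_univ _)]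
    simp
  · rw [Finset.disjoint_left]
    intro q h1 h2
    simp at h1 h2
    omega

lemma poly_slice (m : ℕ) (j : Fin (m+1)) (P : MvPolynomial (Fin (m+1)) ℝ) (hP : P ≠ 0) :
    ∃ Q : Polynomial (MvPolynomial (Fin m) ℝ), Q ≠ 0 ∧ Q.natDegree = P.degreeOf j ∧
      ∀ (t : ℝ) (y : Fin m → ℝ), MvPolynomial.eval (j.insertNth t y : Fin (m+1) → ℝ) P
        = (Q.map (MvPolynomial.eval y)).eval t := by
  refine ⟨MvPolynomial.optionEquivLeft ℝ (Fin m) (MvPolynomial.rename (finSuccEquiv' j) P), ?_, ?_, ?_⟩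
  · rw [Ne, EmbeddingLike.map_eq_zero_iff]
    intro h
    apply hP
    apply MvPolynomial.rename_injective _ (finSuccEquiv' j).injective
    simpa using h
  · rw [MvPolynomial.natDegree_optionEquivLeft]
    have := MvPolynomial.degreeOf_rename_of_injective (p := P) (finSuccEquiv' j).injective j
    rwa [finSuccEquiv'_at] at this
  · intro t y
    rw [← MvPolynomial.optionEquivLeft_elim_eval, MvPolynomial.eval_rename]
    congr 2
    ext i
    refine j.succAboveCases ?_ (fun k => ?_) i <;> simp

lemma one_dim (c s : ℝ) (hc : -1 < c) (hs : c + s < -1) :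
    IntegrableOn (fun x : ℝ => x ^ c * (1 + x) ^ s) (Set.Ioi 0) := by
  have hm : Measurable (fun x : ℝ => x ^ c * (1 + x) ^ s) := by fun_prop
  have hs0 : s < 0 := by linarith
  rw [← Set.Ioc_union_Ioi_eq_Ioi (zero_le_one' ℝ)]
  refine IntegrableOn.union ?_ ?_
  · have h := (intervalIntegral.intervalIntegrable_rpow' (a := 0) (b := 1) hc).1
    refine Integrable.mono' h hm.aestronglyMeasurable ?_
    refine (ae_restrict_iff' measurableSet_Ioc).2 (Eventually.of_forall fun x hx => ?_)
    have h0 : 0 < x := hx.1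
    rw [Real.norm_of_nonneg (by positivity)]
    exact mul_le_of_le_one_right (by positivity) (Real.rpow_le_one_of_one_le_of_nonpos (by linarith) hs0.le)
  · have h := (integrableOn_Ioi_rpow_iff (s := c + s) zero_lt_one).2 hs
    refine Integrable.mono' h hm.aestronglyMeasurable ?_
    refine (ae_restrict_iff' measurableSet_Ioi).2 (Eventually.of_forall fun x hx => ?_)
    have h1 : 1 < x := hx
    have h0 : 0 < x := by linarith
    rw [Real.norm_of_nonneg (by positivity), Real.rpow_add h0]
    gcongr ?_ * ?_
    exact Real.rpow_le_rpow_of_nonpos h0 (by linarith) hs0.le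

/-- The density. -/
noncomputable def sdens (r : ℕ) (a b ν : ℝ) (x : Fin r → ℝ) : ℝ :=
  (∏ j, x j ^ b) * (∏ j, (1 + x j) ^ (-ν)) *
      ∏ q ∈ Finset.univ.filter (fun q : Fin r × Fin r => q.1 < q.2), |x q.1 - x q.2| ^ a

lemma sdens_meas (r : ℕ) (a b ν : ℝ) : Measurable (sdens r a b ν) := by
  unfold sdens
  fun_prop

lemma sdens_nonneg (r : ℕ) (a b ν : ℝ) (x : Fin r → ℝ) (hx : ∀ j, 0 < x j) :
    0 ≤ sdens r a b ν x := by
  unfold sdens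
  have : ∀ j, 0 < 1 + x j := fun j => by linarith [hx j]
  refine mul_nonneg (mul_nonneg ?_ ?_) ?_ <;> refine Finset.prod_nonneg fun i _ => ?_
  · exact Real.rpow_nonneg (hx i).le _
  · exact Real.rpow_nonneg (this i).le _
  · positivity

lemma orth_meas (r : ℕ) : MeasurableSet {x : Fin r → ℝ | ∀ j, 0 < x j} := by
  simp only [Set.ofPred_forall]
  exact MeasurableSet.iInter fun j => measurableSet_lt measurable_const (measurable_pi_apply j)

lemma integrable_selberg_iff (r : ℕ) (a b ν : ℝ) (f : (Fin r → ℝ) → ℝ) :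
    Integrable f (selbergMeasure r a b ν) ↔
      IntegrableOn (fun x => f x * sdens r a b ν x) {x : Fin r → ℝ | ∀ j, 0 < x j} := by
  unfold selbergMeasure
  change Integrable f ((volume.restrict {x : Fin r → ℝ | ∀ j, 0 < x j}).withDensity fun x =>
    ENNReal.ofReal (sdens r a b ν x)) ↔ _
  rw [integrable_withDensity_iff (sdens_meas r a b ν).ennreal_ofReal
    (Eventually.of_forall fun x => ENNReal.ofReal_lt_top)]
  refine integrable_congr ?_
  refine (ae_restrict_iff' (orth_meas r)).2 (Eventually.of_forall fun x hx => ?_)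
  simp only []
  rw [ENNReal.toReal_ofReal (sdens_nonneg r a b ν x hx)]

lemma converse (r : ℕ) (hr : 1 ≤ r) (a b ν : ℝ) (ha : 0 ≤ a) (hb : -1 < b)
    (n : Fin r → ℕ) (hn : ∀ j, 2 * (n j : ℝ) + b + (-ν + ((r:ℝ) - 1) * a) < -1) :
    Integrable (fun x => (∏ j, x j ^ n j) ^ 2) (selbergMeasure r a b ν) := by
  rw [integrable_selberg_iff]
  have hset : {x : Fin r → ℝ | ∀ j, 0 < x j} = Set.univ.pi fun _ => Set.Ioi 0 := by
    ext x; simp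
  have key : IntegrableOn (fun x : Fin r → ℝ => ∏ j, (x j ^ (2 * (n j : ℝ) + b) *
      (1 + x j) ^ (-ν + ((r:ℝ) - 1) * a))) {x : Fin r → ℝ | ∀ j, 0 < x j} := by
    rw [hset, IntegrableOn, volume_pi, Measure.restrict_pi_pi]
    refine Integrable.fintype_prod (f := fun j (t : ℝ) => (t ^ (2 * (n j : ℝ) + b) *
      (1 + t) ^ (-ν + ((r:ℝ) - 1) * a))) fun j => one_dim _ _ ?_ (hn j)
    have : (0:ℝ) ≤ n j := Nat.cast_nonneg _
    linarith
  refine Integrable.mono' key ?_ ?_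
  · exact (Measurable.mul (by fun_prop) (sdens_meas r a b ν)).aestronglyMeasurable
  refine (ae_restrict_iff' (orth_meas r)).2 (Eventually.of_forall fun x hx => ?_)
  have hx : ∀ j, 0 < x j := hx
  have hx1 : ∀ j, 0 < 1 + x j := fun j => by linarith [hx j]
  have hd := sdens_nonneg r a b ν x hx
  rw [Real.norm_of_nonneg (by positivity)]
  have e1 : ∏ j, (x j ^ (2 * (n j : ℝ) + b) * (1 + x j) ^ (-ν + ((r:ℝ) - 1) * a))
      = (∏ j, x j ^ n j) ^ 2 * ((∏ j, x j ^ b) * (∏ j, (1 + x j) ^ (-ν)) *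
        ∏ j, ((1 + x j) ^ a) ^ (r - 1)) := by
    rw [← Finset.prod_pow, ← Finset.prod_mul_distrib, ← Finset.prod_mul_distrib,
      ← Finset.prod_mul_distrib]
    refine Finset.prod_congr rfl fun j _ => ?_
    rw [Real.rpow_add (hx j), Real.rpow_add (hx1 j), ← Real.rpow_natCast ((1 + x j) ^ a),
      ← Real.rpow_mul (hx1 j).le, Nat.cast_sub hr, mul_comm a, mul_comm 2, Real.rpow_mul (hx j).le]
    simp
    ring
  rw [e1, ← pairs_prod]
  unfold sdens
  have p1 : 0 ≤ ∏ j, x j ^ b := Finset.prod_nonneg fun j _ => Real.rpow_nonneg (hx j).le _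
  have p2 : 0 ≤ ∏ j, (1 + x j) ^ (-ν) := Finset.prod_nonneg fun j _ => Real.rpow_nonneg (hx1 j).le _
  refine mul_le_mul_of_nonneg_left (mul_le_mul_of_nonneg_left ?_ (mul_nonneg p1 p2)) (sq_nonneg _)
  refine Finset.prod_le_prod (fun q _ => by positivity) fun q _ => ?_
  rw [← Real.mul_rpow (hx1 _).le (hx1 _).le]
  refine Real.rpow_le_rpow (abs_nonneg _) ?_ ha
  have := hx q.1
  have := hx q.2
  have := mul_pos (hx q.1) (hx q.2)
  rw [abs_le]
  constructor <;> nlinarith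

lemma slice_diverge (m : ℕ) (a b ν : ℝ) (j : Fin (m+1)) (y : Fin m → ℝ) (hy : ∀ i, 0 < y i)
    (hinj : ∀ i k, i < k → y i ≠ y k) (q : Polynomial ℝ) (hq : q ≠ 0)
    (hint : IntegrableOn (fun t : ℝ => (q.eval t) ^ 2 *
      sdens (m+1) a b ν (j.insertNth t y : Fin (m+1) → ℝ)) (Set.Ioi 0)) :
    2 * (q.natDegree : ℝ) + b + (-ν) + a * m < -1 := by
  set s : ℝ := 2 * (q.natDegree : ℝ) + b + (-ν) + a * m with hs
  set X : ℝ → Fin (m+1) → ℝ := fun t => (j.insertNth t y : Fin (m+1) → ℝ) with hX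
  have hXj : ∀ t, X t j = t := fun t => by simp [hX]
  have hXi : ∀ t i, X t (j.succAbove i) = y i := fun t i => by simp [hX]
  -- the individual factors
  have hlin : ∀ c : ℝ, Tendsto (fun t : ℝ => (t + c) / t) atTop (𝓝 1) := by
    intro c
    have h1 : Tendsto (fun t : ℝ => 1 + c * t⁻¹) atTop (𝓝 (1 + c * 0)) :=
      tendsto_const_nhds.add (tendsto_inv_atTop_zero.const_mul c)
    rw [mul_zero, add_zero] at h1
    refine h1.congr' ?_
    filter_upwards [eventually_gt_atTop 0] with t ht
    field_simp
  have hpow : ∀ c e : ℝ, Tendsto (fun t : ℝ => |t + c| ^ e / t ^ e) atTop (𝓝 1) := by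
    intro c e
    have h1 := ((hlin c).abs).rpow_const (p := e) (Or.inl (by simp))
    simp only [abs_one, Real.one_rpow] at h1
    refine h1.congr' ?_
    filter_upwards [eventually_gt_atTop 0] with t ht
    rw [abs_div, abs_of_pos ht, Real.div_rpow (abs_nonneg _) ht.le]
  have T1 : Tendsto (fun t : ℝ => (q.eval t) ^ 2 / t ^ (2 * (q.natDegree : ℝ))) atTop
      (𝓝 (q.leadingCoeff ^ 2)) := by
    have h := Polynomial.div_tendsto_atTop_leadingCoeff_div_of_degree_eq q
      (Polynomial.X ^ q.natDegree : Polynomial ℝ) (by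
        rw [Polynomial.degree_X_pow, Polynomial.degree_eq_natDegree hq])
    rw [Polynomial.leadingCoeff_X_pow, div_one] at h
    refine (h.pow 2).congr' ?_
    filter_upwards [eventually_gt_atTop 0] with t ht
    rw [mul_comm 2, Real.rpow_mul ht.le]
    simp [div_pow]
  have T2 : Tendsto (fun t : ℝ => (∏ i, X t i ^ b) / t ^ b) atTop (𝓝 (∏ i, y i ^ b)) := by
    refine tendsto_const_nhds.congr' ?_
    filter_upwards [eventually_gt_atTop 0] with t ht
    rw [Fin.prod_univ_succAbove _ j]
    simp only [hXj, hXi]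
    have : 0 < t ^ b := by positivity
    field_simp
  have T3 : Tendsto (fun t : ℝ => (∏ i, (1 + X t i) ^ (-ν)) / t ^ (-ν)) atTop
      (𝓝 (1 * ∏ i, (1 + y i) ^ (-ν))) := by
    refine ((hpow 1 (-ν)).mul_const _).congr' ?_
    filter_upwards [eventually_gt_atTop 0] with t ht
    rw [Fin.prod_univ_succAbove _ j]
    simp only [hXj, hXi]
    rw [abs_of_pos (by linarith), add_comm t 1]
    ring
  set f : ℝ → Fin (m+1) → ℝ := fun t i => if i = j then t ^ a else 1 with hf
  have T4' : ∀ p : Fin (m+1) × Fin (m+1), p.1 < p.2 → ∃ C : ℝ, C ≠ 0 ∧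
      Tendsto (fun t : ℝ => |X t p.1 - X t p.2| ^ a / (f t p.1 * f t p.2)) atTop (𝓝 C) := by
    rintro ⟨i, k⟩ hik
    simp only at hik ⊢
    rcases Fin.eq_self_or_eq_succAbove j i with rfl | ⟨i', rfl⟩
    · rcases Fin.eq_self_or_eq_succAbove i k with rfl | ⟨k', rfl⟩
      · exact absurd hik (lt_irrefl _)
      · refine ⟨1, one_ne_zero, (hpow (-y k') a).congr fun t => ?_⟩
        simp [hXj, hXi, hf, sub_eq_add_neg]
    · rcases Fin.eq_self_or_eq_succAbove j k with rfl | ⟨k', rfl⟩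
      · refine ⟨1, one_ne_zero, (hpow (-y i') a).congr fun t => ?_⟩
        rw [abs_sub_comm]
        simp [hXj, hXi, hf, sub_eq_add_neg]
      · refine ⟨|y i' - y k'| ^ a, ?_, tendsto_const_nhds.congr fun t => ?_⟩
        · have : i' < k' := by simpa using hik
          have := abs_pos.2 (sub_ne_zero.2 (hinj i' k' this))
          positivity
        · simp [hXi, hf]
  choose! C hC0 hC using T4'
  have T4 : Tendsto (fun t : ℝ => (∏ p ∈ Finset.univ.filter
      (fun q : Fin (m+1) × Fin (m+1) => q.1 < q.2), |X t p.1 - X t p.2| ^ a) / t ^ (a * m)) atTop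
      (𝓝 (∏ p ∈ Finset.univ.filter
        (fun q : Fin (m+1) × Fin (m+1) => q.1 < q.2), C p)) := by
    have h := tendsto_finsetProd (Finset.univ.filter
      (fun q : Fin (m+1) × Fin (m+1) => q.1 < q.2)) (fun p hp => hC p (Finset.mem_filter.1 hp).2)
    refine h.congr' ?_
    filter_upwards [eventually_gt_atTop 0] with t ht
    rw [Finset.prod_div_distrib, pairs_prod]
    congr 1
    rw [Fin.prod_univ_succAbove _ j]
    simp only [hf, if_true, Fin.succAbove_ne, if_false, one_pow, Finset.prod_const_one, mul_one]
    rw [Real.rpow_mul ht.le]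
    simp
  have T := T1.mul ((T2.mul T3).mul T4)
  have hne : q.leadingCoeff ^ 2 * ((∏ i, y i ^ b) * (1 * ∏ i, (1 + y i) ^ (-ν)) *
      ∏ p ∈ Finset.univ.filter
        (fun q : Fin (m+1) × Fin (m+1) => q.1 < q.2), C p) ≠ 0 := by
    refine mul_ne_zero (pow_ne_zero _ (Polynomial.leadingCoeff_ne_zero.2 hq))
      (mul_ne_zero (mul_ne_zero ?_ (mul_ne_zero one_ne_zero ?_)) ?_) <;>
      refine Finset.prod_ne_zero_iff.2 fun i hi => ?_
    · exact (Real.rpow_pos_of_pos (hy i) _).ne'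
    · exact (Real.rpow_pos_of_pos (by linarith [hy i]) _).ne'
    · exact hC0 i (Finset.mem_filter.1 hi).2
  have hO : (fun t : ℝ => t ^ s) =O[atTop] (fun t : ℝ => (q.eval t) ^ 2 *
      sdens (m+1) a b ν (X t)) := by
    refine IsBigO.of_bound' ?_ |>.trans (isBigO_const_mul_self
      (2 / |q.leadingCoeff ^ 2 * ((∏ i, y i ^ b) * (1 * ∏ i, (1 + y i) ^ (-ν)) *
      ∏ p ∈ Finset.univ.filter
        (fun q : Fin (m+1) × Fin (m+1) => q.1 < q.2), C p)|) _ _)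
    have hev := T.abs.eventually (lt_mem_nhds (half_lt_self (abs_pos.2 hne)))
    filter_upwards [hev, eventually_gt_atTop 0] with t h1 ht
    have hts : t ^ s = t ^ (2 * (q.natDegree : ℝ)) * ((t ^ b * t ^ (-ν)) * t ^ (a * m)) := by
      rw [hs, Real.rpow_add ht, Real.rpow_add ht, Real.rpow_add ht]
      ring
    have hpos : 0 < t ^ s := by positivity
    rw [← mul_div_mul_comm, ← mul_div_mul_comm, ← mul_div_mul_comm, ← hts, abs_div,
      abs_of_pos hpos, lt_div_iff₀ hpos] at h1
    rw [norm_mul, Real.norm_of_nonneg hpos.le, Real.norm_of_nonneg (by positivity),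
      Real.norm_eq_abs]
    unfold sdens
    have := abs_pos.2 hne
    rw [div_mul_eq_mul_div, le_div_iff₀ this]
    linarith
  have hI : IntegrableAtFilter (fun t : ℝ => (q.eval t) ^ 2 *
      sdens (m+1) a b ν (X t)) atTop := ⟨_, Ioi_mem_atTop 0, hint⟩
  refine integrableAtFilter_rpow_atTop_iff.1 (hO.integrableAtFilter ?_ hI)
  exact (Measurable.stronglyMeasurable (by fun_prop)).stronglyMeasurableAtFilter

lemma forward (m : ℕ) (a b ν : ℝ) (P : MvPolynomial (Fin (m+1)) ℝ) (hP : P ≠ 0)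
    (hint : Integrable (fun x => (MvPolynomial.eval x P) ^ 2) (selbergMeasure (m+1) a b ν))
    (j : Fin (m+1)) : 2 * (P.degreeOf j : ℝ) + b + (-ν) + a * m < -1 := by
  obtain ⟨Q, hQ0, hQd, hQe⟩ := poly_slice m j P hP
  rw [integrable_selberg_iff, ← integrable_indicator_iff (orth_meas _)] at hint
  have hmp := (volume_preserving_piFinSuccAbove (fun _ : Fin (m+1) => ℝ) j).symm
  have h2 := (hmp.integrable_comp_emb (MeasurableEquiv.measurableEmbedding _)).2 hint
  have h3 := Integrable.prod_left_ae h2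
  -- the good set
  set R : MvPolynomial (Fin m) ℝ := Q.leadingCoeff *
    ∏ p ∈ Finset.univ.filter (fun p : Fin m × Fin m => p.1 < p.2),
      (MvPolynomial.X p.1 - MvPolynomial.X p.2) with hR
  have hR0 : R ≠ 0 := by
    refine mul_ne_zero (Polynomial.leadingCoeff_ne_zero.2 hQ0) (Finset.prod_ne_zero_iff.2 ?_)
    intro p hp
    rw [sub_ne_zero]
    intro h
    exact (Finset.mem_filter.1 hp).2.ne (MvPolynomial.X_injective h)
  have hopen : IsOpen {y : Fin m → ℝ | (∀ i, 0 < y i) ∧ MvPolynomial.eval y R ≠ 0} := by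
    refine IsOpen.inter ?_ ?_
    · have : {y : Fin m → ℝ | ∀ i, 0 < y i} = Set.univ.pi fun _ => Set.Ioi 0 := by ext; simp
      change IsOpen {y : Fin m → ℝ | ∀ i, 0 < y i}
      rw [this]
      exact isOpen_set_pi Set.finite_univ fun _ _ => isOpen_Ioi
    · exact isOpen_ne_fun (MvPolynomial.continuous_eval R) continuous_const
  have hnon : {y : Fin m → ℝ | (∀ i, 0 < y i) ∧ MvPolynomial.eval y R ≠ 0}.Nonempty := by
    by_contra hcon
    apply hR0
    refine MvPolynomial.funext_set (fun _ => Set.Ioi (0:ℝ)) (fun _ => Set.Ioi_infinite 0) ?_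
    intro x hx
    by_contra h
    exact hcon ⟨x, by simpa using hx, by simpa using h⟩
  have hpos := hopen.measure_pos volume hnon
  obtain ⟨y, ⟨hy, hyR⟩, hyi⟩ : ∃ y : Fin m → ℝ,
      y ∈ {y : Fin m → ℝ | (∀ i, 0 < y i) ∧ MvPolynomial.eval y R ≠ 0} ∧ _ :=
    Frequently.exists ((frequently_ae_mem_iff.2 hpos.ne').and_eventually h3)
  rw [hR, map_mul, map_prod] at hyR
  obtain ⟨hl, hv⟩ := mul_ne_zero_iff.1 hyR
  have hdeg : (Q.map (MvPolynomial.eval y)).natDegree = Q.natDegree :=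
    Polynomial.natDegree_map_of_leadingCoeff_ne_zero _ hl
  have := slice_diverge m a b ν j y hy ?_ (Q.map (MvPolynomial.eval y)) ?_ ?_
  · rwa [hdeg, hQd] at this
  · intro i k hik h
    refine Finset.prod_ne_zero_iff.1 hv (i, k) (by simpa using hik) ?_
    simp [h]
  · intro h
    apply hl
    have := congrArg (fun q => q.coeff Q.natDegree) h
    simpa using this
  · rw [← integrable_indicator_iff measurableSet_Ioi]
    refine hyi.congr (Eventually.of_forall fun t => ?_)
    have hiff : (j.insertNth t y : Fin (m+1) → ℝ) ∈ {x : Fin (m+1) → ℝ | ∀ j, 0 < x j} ↔ 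
        t ∈ Set.Ioi (0:ℝ) := by
      simp [Fin.forall_iff_succAbove j, hy]
    change Set.indicator _ _ (j.insertNth t y : Fin (m+1) → ℝ) = _
    by_cases ht : t ∈ Set.Ioi (0:ℝ)
    · rw [Set.indicator_of_mem ht, Set.indicator_of_mem (hiff.2 ht), hQe]
    · rw [Set.indicator_of_notMem ht, Set.indicator_of_notMem (fun h => ht (hiff.1 h))]

theorem stmt14 (r : ℕ) (hr : 1 ≤ r) (a b ν : ℝ) (ha : 0 ≤ a) (hb : -1 < b)
    (p : ℝ) (hp : p = ((r : ℝ) - 1) * a + b + 2) :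
    (∀ P : MvPolynomial (Fin r) ℝ, P ≠ 0 →
      Integrable (fun x => (MvPolynomial.eval x P) ^ 2) (selbergMeasure r a b ν) →
      ∀ j : Fin r, (P.degreeOf j : ℝ) < (ν - p + 1) / 2) ∧
    (∀ n : Fin r → ℕ, (∀ j, (n j : ℝ) < (ν - p + 1) / 2) →
      Integrable (fun x => (∏ j, x j ^ n j) ^ 2) (selbergMeasure r a b ν)) := by
  refine ⟨fun P hP hint j => ?_, fun n hn => ?_⟩
  · obtain ⟨m, rfl⟩ : ∃ m, r = m + 1 := ⟨r - 1, by omega⟩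
    have := forward m a b ν P hP hint j
    push_cast at hp
    rw [lt_div_iff₀ two_pos]
    linarith
  · refine converse r hr a b ν ha hb n fun j => ?_
    have := hn j
    rw [lt_div_iff₀ two_pos] at this
    linarith
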